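/- arXiv:2604.26190 — 4 statements merged into one kernel-verified Lean document; each statement's English description precedes it below -/
import Mathlib

section
/- Even-run uniqueness: if a nonempty string s has an even number r of maximal runs, then the Flashback decomposition is the unique token-minimal admissible bilateral run-peeling decomposition of s; that is, any admissible decomposition using exactly ⌈r/2⌉ content tokens must peel both boundary runs completely at every non-terminal step. -/
/-- The alphabet `α` extended with two sentinel symbols `@` and `$`. -/
abbrev Symb (α : Type*) := α ⊕ Bool

/-- The sentinel `@`. -/
def atSym {α : Type*} : Symb α := Sum.inr false

/-- The sentinel `$`. -/
def dollarSym {α : Type*} : Symb α := Sum.inr true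

instance {α : Type*} : Inhabited (Symb α) := ⟨atSym⟩

/-- A bilateral token: a symbol string together with a split position. -/
structure Tok (β : Type*) where
  sym : List β
  split : ℕ
  deriving DecidableEq

instance {β : Type*} : Inhabited (Tok β) := ⟨⟨[], 0⟩⟩

/-- Fuel-based bilateral peeling.  On a nonempty span: if the span is a single
maximal run, emit the terminal token `(span, 0)`; otherwise remove the maximal
leading run and the maximal trailing run, emit the token whose symbol string is
the leading run concatenated with the trailing run (split = leading-run length,
or split 0 and stop if nothing remains in the middle), and recurse on the
middle.  Any fuel `≥` the span length suffices. -/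
def peelF {β : Type*} [DecidableEq β] : ℕ → List β → List (Tok β)
  | 0, _ => []
  | _ + 1, [] => []
  | fuel + 1, a :: t =>
    let w := a :: t
    let front := w.takeWhile (fun x => decide (x = a))
    let rest := w.dropWhile (fun x => decide (x = a))
    if rest.isEmpty then [⟨w, 0⟩]
    else
      let z := w.getLastD a
      let back := (w.reverse.takeWhile (fun x => decide (x = z))).reverse
      let mid := rest.take (rest.length - back.length)
      if mid.isEmpty then [⟨front ++ back, 0⟩]
      else ⟨front ++ back, front.length⟩ :: peelF fuel mid

/-- The sentinel-wrapped form `ŝ = @ · s · $`. -/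
def wrap {α : Type*} (s : List α) : List (Symb α) :=
  atSym :: s.map Sum.inl ++ [dollarSym]

/-- The Flashback decomposition `F(s)`. -/
def flashback {α : Type*} [DecidableEq α] (s : List α) : List (Tok (Symb α)) :=
  peelF (wrap s).length (wrap s)

/-- Inside-out nesting of a token sequence: the innermost symbol string is
returned verbatim, and each earlier token contributes `front ‖ inner ‖ back`. -/
def nestTok {β : Type*} : List (Tok β) → List β
  | [] => []
  | [τ] => τ.sym
  | τ :: rest => τ.sym.take τ.split ++ nestTok rest ++ τ.sym.drop τ.split

/-- The Flashback reconstruction `F⁻¹(T)`: nest the tokens and strip the two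
sentinels. -/
def reconstruct {α : Type*} (T : List (Tok (Symb α))) : List α :=
  (((nestTok T).drop 1).dropLast).filterMap Sum.getLeft?

/-- The number of maximal runs of a string. -/
def runCount {α : Type*} [DecidableEq α] : List α → ℕ
  | [] => 0
  | [_] => 1
  | a :: b :: t => (if a = b then 0 else 1) + runCount (b :: t)

/-- Length of the maximal leading run. -/
def leadRunLen {α : Type*} [DecidableEq α] : List α → ℕ
  | [] => 0
  | a :: t => (t.takeWhile (fun x => decide (x = a))).length + 1

/-- Length of the maximal trailing run. -/
def trailRunLen {α : Type*} [DecidableEq α] (w : List α) : ℕ :=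
  leadRunLen w.reverse

/-- Admissible bilateral run-peeling decompositions of a nonempty span: if the
span consists of at most two maximal runs, emit one terminal token for the span
and stop; otherwise choose any `1 ≤ x ≤ L` and `1 ≤ y ≤ R` (where `L`, `R` are
the lengths of the maximal leading and trailing runs), emit the content token
formed by the peeled prefix of length `x` and the peeled suffix of length `y`,
and recurse on the remaining middle.  Flashback is the special case
`x = L`, `y = R` at every step. -/
inductive Admissible {α : Type*} [DecidableEq α] : List α → List (Tok α) → Prop
  | terminal (w : List α) (hw : w ≠ []) (hr : runCount w ≤ 2) :
      Admissible w [⟨w, 0⟩]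
  | step (w : List α) (x y : ℕ) (T : List (Tok α)) (hw : w ≠ [])
      (hr : 3 ≤ runCount w)
      (hx1 : 1 ≤ x) (hx2 : x ≤ leadRunLen w)
      (hy1 : 1 ≤ y) (hy2 : y ≤ trailRunLen w)
      (ih : Admissible ((w.drop x).take (w.length - x - y)) T) :
      Admissible w (⟨w.take x ++ w.drop (w.length - y), x⟩ :: T)

theorem runCount_pos {α : Type*} [DecidableEq α] (a : α) (t : List α) :
    1 ≤ runCount (a :: t) := by
  induction t generalizing a with
  | nil => simp [runCount]
  | cons b t ih => have := ih b; rw [runCount]; omega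

theorem runCount_append_singleton {α : Type*} [DecidableEq α] (u : List α) (c : α) :
    runCount (u ++ [c]) = runCount u + if u.getLast? = some c then 0 else 1 := by
  induction u with
  | nil => simp [runCount]
  | cons a u ih =>
    cases u with
    | nil => simp [runCount]; grind
    | cons b u =>
      simp only [List.cons_append, runCount, List.getLast?_cons_cons] at ih ⊢
      omega

theorem runCount_reverse {α : Type*} [DecidableEq α] (w : List α) :
    runCount w.reverse = runCount w := by
  induction w with
  | nil => rfl
  | cons a t ih =>
    rw [List.reverse_cons, runCount_append_singleton, ih, List.getLast?_reverse]
    cases t with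
    | nil => simp [runCount]
    | cons b t =>
      simp only [List.head?_cons, Option.some.injEq, runCount, eq_comm (a := b)]
      omega

theorem leadRunLen_cons_cons {α : Type*} [DecidableEq α] (a b : α) (t : List α) :
    leadRunLen (a :: b :: t) = if a = b then leadRunLen (b :: t) + 1 else 1 := by
  by_cases h : a = b
  · subst h; simp [leadRunLen]
  · simp [leadRunLen, h, Ne.symm h]

/-- Dropping part of the leading run keeps the run count; dropping all of it lowers it by one. -/
theorem runCount_drop {α : Type*} [DecidableEq α] (w : List α) (hw : w ≠ []) (x : ℕ)
    (hx : x ≤ leadRunLen w) :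
    runCount (w.drop x) + (if x = leadRunLen w then 1 else 0) = runCount w := by
  induction w generalizing x with
  | nil => exact absurd rfl hw
  | cons a t ih =>
    rcases x with _ | x
    · simp [leadRunLen]
    cases t with
    | nil =>
      have : x = 0 := by simpa [leadRunLen] using hx
      simp [this, runCount, leadRunLen]
    | cons b t =>
      rw [leadRunLen_cons_cons] at hx ⊢
      by_cases h : a = b
      · simp only [h, if_true] at hx ⊢
        have := ih (by simp) x (by omega)
        simpa [runCount] using this
      · simp only [h, if_false] at hx ⊢
        have : x = 0 := by omega
        simp [this, runCount, h, add_comm]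

theorem leadRunLen_append {α : Type*} [DecidableEq α] (u v : List α) (hu : 2 ≤ runCount u) :
    leadRunLen (u ++ v) = leadRunLen u := by
  induction u with
  | nil => simp [runCount] at hu
  | cons a t ih =>
    cases t with
    | nil => simp [runCount] at hu
    | cons b t =>
      simp only [List.cons_append, leadRunLen_cons_cons] at ih ⊢
      by_cases h : a = b
      · rw [if_pos h, if_pos h, ih (by simpa [runCount, h] using hu)]
      · rw [if_neg h, if_neg h]

theorem take_drop_eq_reverse {α : Type*} (w : List α) (x y : ℕ) :
    (w.drop x).take (w.length - x - y) = ((w.drop x).reverse.drop y).reverse := by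
  rw [List.drop_reverse, List.reverse_reverse, List.length_drop]

/-- One bilateral peeling step lowers the run count once for each boundary run peeled fully. -/
theorem runCount_middle {α : Type*} [DecidableEq α] (w : List α) (x y : ℕ)
    (hr : 3 ≤ runCount w) (hx : x ≤ leadRunLen w) (hy : y ≤ trailRunLen w) :
    runCount ((w.drop x).take (w.length - x - y)) + (if x = leadRunLen w then 1 else 0) +
      (if y = trailRunLen w then 1 else 0) = runCount w := by
  have hw : w ≠ [] := by rintro rfl; simp [runCount] at hr
  have h1 := runCount_drop w hw x hx
  have h2 : 2 ≤ runCount (w.drop x) := by split at h1 <;> omega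
  have h3 : trailRunLen w = leadRunLen (w.drop x).reverse := by
    rw [← leadRunLen_append _ (w.take x).reverse (by rwa [runCount_reverse]),
      ← List.reverse_append, List.take_append_drop, trailRunLen]
  have h4 : (w.drop x).reverse ≠ [] := by
    intro h
    rw [List.reverse_eq_nil_iff.mp h] at h2
    simp [runCount] at h2
  have h5 := runCount_drop _ h4 y (h3 ▸ hy)
  rw [runCount_reverse, ← h3] at h5
  rw [take_drop_eq_reverse, runCount_reverse]
  omega

theorem Admissible.runCount_le {α : Type*} [DecidableEq α] {w : List α} {T : List (Tok α)}
    (h : Admissible w T) : runCount w ≤ 2 * T.length := by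
  induction h with
  | terminal w hw hr => simpa using hr
  | step w x y T hw hr hx1 hx2 hy1 hy2 _ ih =>
    have := runCount_middle w x y hr hx2 hy2
    rw [List.length_cons]
    split at this <;> split at this <;> omega

theorem eq_replicate_of_runCount_eq_one {α : Type*} [DecidableEq α] (a : α) (t : List α)
    (h : runCount (a :: t) = 1) : t = List.replicate t.length a := by
  induction t generalizing a with
  | nil => rfl
  | cons b t ih =>
    have := runCount_pos b t
    rw [runCount] at h
    have hab : a = b := by by_contra hab; rw [if_neg hab] at h; omega
    subst hab
    rw [List.length_cons, List.replicate_succ, ← ih a (by simpa using h)]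

theorem exists_replicate_of_runCount_eq_two {α : Type*} [DecidableEq α] (w : List α)
    (h : runCount w = 2) : ∃ (a b : α) (m n : ℕ), a ≠ b ∧
      w = List.replicate (m + 1) a ++ List.replicate (n + 1) b := by
  induction w with
  | nil => simp [runCount] at h
  | cons a t ih =>
    cases t with
    | nil => simp [runCount] at h
    | cons b t =>
      rw [runCount] at h
      by_cases hab : a = b
      · obtain ⟨c, d, m, n, hcd, hw⟩ := ih (by simpa [hab] using h)
        have hbc : b = c := by simpa [List.replicate_succ] using congrArg List.head? hw
        refine ⟨c, d, m + 1, n, hcd, ?_⟩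
        rw [hw, hab, hbc, List.replicate_succ (n := m + 1), List.cons_append]
      · refine ⟨a, b, 0, t.length, hab, ?_⟩
        rw [if_neg hab] at h
        rw [List.replicate_succ (n := t.length),
          ← eq_replicate_of_runCount_eq_one b t (by omega)]
        rfl

theorem peelF_of_runCount_eq_two {α : Type*} [DecidableEq α] (w : List α)
    (h : runCount w = 2) (n : ℕ) : peelF (n + 1) w = [⟨w, 0⟩] := by
  obtain ⟨a, b, k, l, hab, rfl⟩ := exists_replicate_of_runCount_eq_two w h
  have hf : (List.replicate (k + 1) a ++ List.replicate (l + 1) b).takeWhile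
      (fun x => decide (x = a)) = List.replicate (k + 1) a := by
    rw [List.takeWhile_append_of_pos (by simp)]
    simp [List.replicate_succ (n := l), hab.symm]
  have hd : (List.replicate (k + 1) a ++ List.replicate (l + 1) b).dropWhile
      (fun x => decide (x = a)) = List.replicate (l + 1) b := by
    rw [List.dropWhile_append_of_pos (by simp)]
    simp [List.replicate_succ (n := l), hab.symm]
  have hz : (List.replicate (k + 1) a ++ List.replicate (l + 1) b).getLastD a = b := by
    rw [List.getLastD_eq_getLast?]
    simp [List.getLast?_append, List.getLast?_replicate]
  have hb : ((List.replicate (k + 1) a ++ List.replicate (l + 1) b).reverse.takeWhile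
      (fun x => decide (x = b))).reverse = List.replicate (l + 1) b := by
    rw [List.reverse_append, List.reverse_replicate, List.reverse_replicate,
      List.takeWhile_append_of_pos (by simp)]
    simp [List.replicate_succ (n := k), hab]
  generalize hw : List.replicate (k + 1) a ++ List.replicate (l + 1) b = w at *
  obtain ⟨t, rfl⟩ : ∃ t, w = a :: t := ⟨_, by rw [← hw, List.replicate_succ, List.cons_append]⟩
  simp only [peelF, hf, hd, hz, hb]
  simp [hw]

theorem takeWhile_eq_take_leadRunLen {α : Type*} [DecidableEq α] (a : α) (t : List α) :
    (a :: t).takeWhile (fun x => decide (x = a)) = (a :: t).take (leadRunLen (a :: t)) := by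
  have h := List.prefix_iff_eq_take.mp
    (List.takeWhile_prefix (l := a :: t) (fun x => decide (x = a)))
  rw [h]
  simp [leadRunLen]

theorem dropWhile_eq_drop_leadRunLen {α : Type*} [DecidableEq α] (a : α) (t : List α) :
    (a :: t).dropWhile (fun x => decide (x = a)) = (a :: t).drop (leadRunLen (a :: t)) := by
  have h := List.takeWhile_append_dropWhile (p := fun x => decide (x = a)) (l := a :: t)
  rw [takeWhile_eq_take_leadRunLen] at h
  exact List.append_cancel_left (h.trans (List.take_append_drop _ _).symm)

theorem reverse_takeWhile_eq_drop_trailRunLen {α : Type*} [DecidableEq α] (a : α) (t : List α) :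
    ((a :: t).reverse.takeWhile (fun x => decide (x = (a :: t).getLastD a))).reverse =
      (a :: t).drop ((a :: t).length - trailRunLen (a :: t)) := by
  rw [trailRunLen]
  obtain ⟨z, v, hv⟩ : ∃ z v, (a :: t).reverse = z :: v :=
    List.exists_cons_of_ne_nil (by simp)
  have hz : (a :: t).getLastD a = z := by
    rw [List.getLastD_eq_getLast?, ← List.head?_reverse, hv]; rfl
  rw [hz, hv, takeWhile_eq_take_leadRunLen, ← hv, List.take_reverse, List.reverse_reverse]

theorem leadRunLen_le_length {α : Type*} [DecidableEq α] (w : List α) :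
    leadRunLen w ≤ w.length := by
  cases w with
  | nil => simp [leadRunLen]
  | cons a t => simpa [leadRunLen] using (List.takeWhile_prefix _).length_le

theorem peelF_of_three_le_runCount {α : Type*} [DecidableEq α] (w : List α)
    (h : 3 ≤ runCount w) (n : ℕ) :
    peelF (n + 1) w =
      ⟨w.take (leadRunLen w) ++ w.drop (w.length - trailRunLen w), leadRunLen w⟩ ::
        peelF n ((w.drop (leadRunLen w)).take (w.length - leadRunLen w - trailRunLen w)) := by
  have hm := runCount_middle w _ _ h le_rfl le_rfl
  simp only [if_true] at hm
  have hmid : (w.drop (leadRunLen w)).take (w.length - leadRunLen w - trailRunLen w) ≠ [] := by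
    intro h0
    rw [h0, runCount] at hm
    omega
  have hrest : w.drop (leadRunLen w) ≠ [] := by
    intro h0
    simp [h0] at hmid
  obtain _ | ⟨a, t⟩ := w
  · simp [runCount] at h
  have hR : trailRunLen (a :: t) ≤ (a :: t).length := by
    simpa [trailRunLen] using leadRunLen_le_length (a :: t).reverse
  have hL : (List.take (leadRunLen (a :: t)) (a :: t)).length = leadRunLen (a :: t) :=
    List.length_take_of_le (leadRunLen_le_length _)
  have hlen : ((a :: t).drop ((a :: t).length - trailRunLen (a :: t))).length =
      trailRunLen (a :: t) := by
    rw [List.length_drop]; omega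
  simp only [peelF]
  rw [dropWhile_eq_drop_leadRunLen, takeWhile_eq_take_leadRunLen,
    reverse_takeWhile_eq_drop_trailRunLen, hlen, hL, List.length_drop,
    if_neg (by rwa [List.isEmpty_iff]), if_neg (by rwa [List.isEmpty_iff])]

theorem Admissible.eq_peelF {α : Type*} [DecidableEq α] {w : List α} {T : List (Tok α)}
    (h : Admissible w T) (hT : runCount w = 2 * T.length) (n : ℕ) (hn : w.length ≤ n) :
    T = peelF n w := by
  induction h generalizing n with
  | terminal w hw hr =>
    obtain _ | n := n
    · exact absurd (List.length_eq_zero_iff.mp (Nat.le_zero.mp hn)) hw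
    · rw [peelF_of_runCount_eq_two w (by simpa using hT)]
  | step w x y T hw hr hx1 hx2 hy1 hy2 hadm ih =>
    obtain _ | n := n
    · exact absurd (List.length_eq_zero_iff.mp (Nat.le_zero.mp hn)) hw
    have hm := runCount_middle w x y hr hx2 hy2
    have hle := hadm.runCount_le
    rw [List.length_cons] at hT
    have hx : x = leadRunLen w := by
      by_contra hx; rw [if_neg hx] at hm; split at hm <;> omega
    have hy : y = trailRunLen w := by
      by_contra hy; rw [if_neg hy] at hm; split at hm <;> omega
    rw [if_pos hx, if_pos hy] at hm
    have hlen : ((w.drop x).take (w.length - x - y)).length ≤ n := by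
      rw [List.length_take]; omega
    rw [peelF_of_three_le_runCount w hr, ← hx, ← hy, ← ih (by omega) n hlen]

/-- **Even-run uniqueness.**  If a nonempty string `s` has an even number `r`
of maximal runs, then the Flashback decomposition (the maximal peeling
`peelF s.length s` of the bare string) is the unique token-minimal admissible
bilateral run-peeling decomposition of `s`: any admissible decomposition using
exactly `⌈r/2⌉` content tokens coincides with it. -/
theorem admissible_even_run_uniqueness {α : Type*} [DecidableEq α]
    (s : List α) (hs : s ≠ []) (hr : runCount s % 2 = 0) :
    ∀ T : List (Tok α), Admissible s T → T.length = (runCount s + 1) / 2 →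
      T = peelF s.length s := by
  intro T hT hlen
  exact hT.eq_peelF (by omega) s.length le_rfl
end

section
/- Kernel structure: let s be a nonempty string with run-length encoding s = a₁^{m₁} ⋯ a_r^{m_r} and h = ⌈r/2⌉. The peeling kernel K(s) (the symbol string of the terminal token of F(s)) equals a_h^{m_h} if r is odd, and a_h^{m_h} · a_{h+1}^{m_{h+1}} if r is even; in either case the kernel contains at most 2 distinct symbols. -/
/-- Expansion of a run-length encoding given by 1-indexed run symbols `a i`
and run multiplicities `m i`, with `r` runs:
`a 1 ^ m 1 ++ a 2 ^ m 2 ++ ⋯ ++ a r ^ m r`. -/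
def rleOfFun {α : Type*} (a : ℕ → α) (m : ℕ → ℕ) (r : ℕ) : List α :=
  (List.range r).flatMap fun i => List.replicate (m (i + 1)) (a (i + 1))

theorem takeWhile_replicate_append {β : Type*} [DecidableEq β] (x : β) (k : ℕ) (l : List β)
    (hl : ∀ h ∈ l.head?, h ≠ x) :
    (List.replicate k x ++ l).takeWhile (fun y => decide (y = x)) = List.replicate k x := by
  rw [List.takeWhile_append_of_pos (by simp +contextual [List.mem_replicate])]
  cases l with
  | nil => simp
  | cons b t => simp [hl b (by simp)]

theorem dropWhile_replicate_append {β : Type*} [DecidableEq β] (x : β) (k : ℕ) (l : List β)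
    (hl : ∀ h ∈ l.head?, h ≠ x) :
    (List.replicate k x ++ l).dropWhile (fun y => decide (y = x)) = l := by
  rw [List.dropWhile_append_of_pos (by simp +contextual [List.mem_replicate])]
  cases l with
  | nil => simp
  | cons b t => simp [hl b (by simp)]

theorem peelF_replicate {β : Type*} [DecidableEq β] (f k : ℕ) (x : β) :
    peelF (f + 1) (List.replicate (k + 1) x) = [⟨List.replicate (k + 1) x, 0⟩] := by
  have h := dropWhile_replicate_append x (k + 1) [] (by simp)
  rw [List.append_nil, List.replicate_succ] at h
  rw [List.replicate_succ, peelF]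
  simp [h]

theorem peelF_append {β : Type*} [DecidableEq β] (f k l : ℕ) (x y : β) (mid : List β)
    (hx : ∀ h ∈ (mid ++ List.replicate (l + 1) y).head?, h ≠ x)
    (hy : ∀ h ∈ (List.replicate (k + 1) x ++ mid).getLast?, h ≠ y) :
    peelF (f + 1) (List.replicate (k + 1) x ++ (mid ++ List.replicate (l + 1) y)) =
      if mid.isEmpty then [⟨List.replicate (k + 1) x ++ List.replicate (l + 1) y, 0⟩]
      else ⟨List.replicate (k + 1) x ++ List.replicate (l + 1) y, k + 1⟩ :: peelF f mid := by
  have htake := takeWhile_replicate_append x (k + 1) _ hx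
  have hdrop := dropWhile_replicate_append x (k + 1) _ hx
  have hback : (List.replicate (k + 1) x ++ (mid ++ List.replicate (l + 1) y)).reverse.takeWhile
      (fun b => decide (b = y)) = List.replicate (l + 1) y := by
    rw [← List.append_assoc, List.reverse_append, List.reverse_replicate]
    exact takeWhile_replicate_append y (l + 1) _ (by simpa only [List.head?_reverse] using hy)
  have hlast : (List.replicate (k + 1) x ++ (mid ++ List.replicate (l + 1) y)).getLastD x = y := by
    rw [← List.append_assoc, List.replicate_succ' (n := l), ← List.append_assoc]
    simp [List.getLastD_eq_getLast?]
  rw [List.replicate_succ (n := k), List.cons_append] at htake hdrop hback hlast ⊢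
  rw [peelF]
  simp only [htake, hdrop, hlast, hback]
  simp

/-- The `n` consecutive runs with indices `i, …, i + n - 1`. -/
def runsFrom {β : Type*} (a : ℕ → β) (m : ℕ → ℕ) (i n : ℕ) : List β :=
  (List.range n).flatMap fun j => List.replicate (m (i + j)) (a (i + j))

theorem runsFrom_succ {β : Type*} (a : ℕ → β) (m : ℕ → ℕ) (i n : ℕ) :
    runsFrom a m i (n + 1) = runsFrom a m i n ++ List.replicate (m (i + n)) (a (i + n)) := by
  simp [runsFrom, List.range_succ]

theorem runsFrom_succ' {β : Type*} (a : ℕ → β) (m : ℕ → ℕ) (i n : ℕ) :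
    runsFrom a m i (n + 1) = List.replicate (m i) (a i) ++ runsFrom a m (i + 1) n := by
  simp [runsFrom, List.range_succ_eq_map, List.flatMap_map, Nat.add_assoc, Nat.add_comm 1]

theorem map_runsFrom {β γ : Type*} (g : β → γ) (a : ℕ → β) (m : ℕ → ℕ) (i n : ℕ) :
    (runsFrom a m i n).map g = runsFrom (g ∘ a) m i n := by
  simp [runsFrom, List.map_flatMap]

theorem head?_runsFrom_succ {β : Type*} (a : ℕ → β) (m : ℕ → ℕ) (i n : ℕ) (hm : 1 ≤ m i) :
    (runsFrom a m i (n + 1)).head? = some (a i) := by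
  obtain ⟨k, hk⟩ := Nat.exists_eq_add_of_le' hm
  simp [runsFrom_succ', hk, List.replicate_succ]

theorem getLast?_runsFrom_succ {β : Type*} (a : ℕ → β) (m : ℕ → ℕ) (i n : ℕ)
    (hm : 1 ≤ m (i + n)) :
    (runsFrom a m i (n + 1)).getLast? = some (a (i + n)) := by
  obtain ⟨k, hk⟩ := Nat.exists_eq_add_of_le' hm
  rw [runsFrom_succ, hk, List.replicate_succ', ← List.append_assoc]
  simp

theorem runsFrom_ne_nil {β : Type*} (a : ℕ → β) (m : ℕ → ℕ) (i n : ℕ) (hm : 1 ≤ m i) :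
    runsFrom a m i (n + 1) ≠ [] := by
  intro h
  simpa [h] using head?_runsFrom_succ a m i n hm

theorem peelF_runsFrom {β : Type*} [DecidableEq β] (a : ℕ → β) (m : ℕ → ℕ) (i n f : ℕ)
    (hm : ∀ j, i ≤ j → j < i + (n + 2) → 1 ≤ m j)
    (ha : ∀ j, i ≤ j → j + 1 < i + (n + 2) → a j ≠ a (j + 1)) :
    peelF (f + 1) (runsFrom a m i (n + 2)) =
      if n = 0 then [⟨runsFrom a m i 2, 0⟩]
      else ⟨List.replicate (m i) (a i) ++
        List.replicate (m (i + (n + 1))) (a (i + (n + 1))), m i⟩ ::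
          peelF f (runsFrom a m (i + 1) n) := by
  obtain ⟨k, hk⟩ := Nat.exists_eq_add_of_le' (hm i le_rfl (by omega))
  obtain ⟨l, hl⟩ := Nat.exists_eq_add_of_le' (hm (i + 1 + n) (by omega) (by omega))
  have hx : ∀ h ∈ (runsFrom a m (i + 1) n ++ List.replicate (l + 1) (a (i + 1 + n))).head?,
      h ≠ a i := by
    rw [← hl, ← runsFrom_succ, head?_runsFrom_succ _ _ _ _ (hm _ (by omega) (by omega))]
    simpa using (ha i le_rfl (by omega)).symm
  have hy : ∀ h ∈ (List.replicate (k + 1) (a i) ++ runsFrom a m (i + 1) n).getLast?,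
      h ≠ a (i + 1 + n) := by
    rw [← hk, ← runsFrom_succ', getLast?_runsFrom_succ _ _ _ _ (hm _ (by omega) (by omega))]
    simpa [Nat.add_assoc, Nat.add_comm 1] using ha (i + n) (by omega) (by omega)
  have h := peelF_append f k l (a i) (a (i + 1 + n)) (runsFrom a m (i + 1) n) hx hy
  rw [← hk, ← hl, ← runsFrom_succ, ← runsFrom_succ'] at h
  rw [h]
  cases n with
  | zero => simp [runsFrom, List.range_succ]
  | succ n =>
    have hne := runsFrom_ne_nil a m (i + 1) n (hm _ (by omega) (by omega))
    simp [hne, Nat.add_comm 1, Nat.add_assoc]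

theorem length_runsFrom_lt {β : Type*} (a : ℕ → β) (m : ℕ → ℕ) (i n : ℕ) (hm : 1 ≤ m i) :
    (runsFrom a m (i + 1) n).length < (runsFrom a m i (n + 2)).length := by
  rw [runsFrom_succ', runsFrom_succ]
  simp only [List.length_append, List.length_replicate]
  omega

theorem peelF_runsFrom_getLastD {β : Type*} [DecidableEq β] (a : ℕ → β) (m : ℕ → ℕ) (n : ℕ) :
    ∀ (i f : ℕ) (d : Tok β), (runsFrom a m i (n + 1)).length ≤ f →
      (∀ j, i ≤ j → j < i + (n + 1) → 1 ≤ m j) →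
      (∀ j, i ≤ j → j + 1 < i + (n + 1) → a j ≠ a (j + 1)) →
      ((peelF f (runsFrom a m i (n + 1))).getLastD d).sym =
        runsFrom a m (i + n / 2) (1 + n % 2) := by
  induction n using Nat.twoStepInduction with
  | zero =>
    intro i f d hf hm _
    obtain ⟨k, hk⟩ := Nat.exists_eq_add_of_le' (hm i le_rfl (by omega))
    have hrun : runsFrom a m i 1 = List.replicate (k + 1) (a i) := by simp [runsFrom, hk]
    simp only [Nat.zero_add, hrun, List.length_replicate] at hf ⊢
    obtain ⟨f, rfl⟩ : ∃ g, f = g + 1 := ⟨f - 1, by omega⟩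
    simp [peelF_replicate, hrun]
  | one =>
    intro i f d hf hm ha
    have hlt : _ < (runsFrom a m i (1 + 1)).length :=
      length_runsFrom_lt a m i 0 (hm i le_rfl (by omega))
    obtain ⟨f, rfl⟩ : ∃ g, f = g + 1 := ⟨f - 1, by omega⟩
    rw [peelF_runsFrom a m i 0 _ hm ha]
    simp
  | more n ih _ =>
    intro i f d hf hm ha
    have hlt : _ < (runsFrom a m i (n + 2 + 1)).length :=
      length_runsFrom_lt a m i (n + 1) (hm i le_rfl (by omega))
    obtain ⟨f, rfl⟩ : ∃ g, f = g + 1 := ⟨f - 1, by omega⟩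
    rw [peelF_runsFrom a m i (n + 1) _ hm ha, if_neg (by omega), List.getLastD_cons,
      ih (i + 1) f _ (by omega) (fun j _ _ => hm j (by omega) (by omega))
        (fun j _ _ => ha j (by omega) (by omega))]
    congr 1 <;> omega

theorem flashback_eq_cons {α : Type*} [DecidableEq α] (s : List α) (hs : s ≠ []) :
    flashback s = ⟨[atSym, dollarSym], 1⟩ :: peelF (s.length + 1) (s.map Sum.inl) := by
  have h := peelF_append (s.length + 1) 0 0 (atSym (α := α)) dollarSym (s.map Sum.inl)
    (by cases s <;> simp_all [atSym])
    (by
      intro b hb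
      have := List.mem_of_mem_getLast? hb
      rintro rfl
      simp [atSym, dollarSym] at this)
  simpa [flashback, wrap, hs] using h

theorem card_toFinset_runsFrom_le {β : Type*} [DecidableEq β] (a : ℕ → β) (m : ℕ → ℕ)
    (i n : ℕ) : (runsFrom a m i n).toFinset.card ≤ n := by
  induction n with
  | zero => simp [runsFrom]
  | succ n ih =>
    rw [runsFrom_succ, List.toFinset_append]
    refine (Finset.card_union_le _ _).trans (Nat.add_le_add ih ?_)
    refine (Finset.card_le_card (t := {a (i + n)}) fun b hb => ?_).trans
      (Finset.card_singleton _).le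
    simpa using List.eq_of_mem_replicate (List.mem_toFinset.mp hb)

/-- **Kernel structure.**  Let `s` be a nonempty string with run-length
encoding `s = a₁^{m₁} ⋯ a_r^{m_r}` and `h = ⌈r/2⌉`.  The peeling kernel
`K(s)` (the symbol string of the terminal token of `F(s)`) equals `a_h^{m_h}`
if `r` is odd and `a_h^{m_h} · a_{h+1}^{m_{h+1}}` if `r` is even; in either
case the kernel contains at most `2` distinct symbols. -/
theorem flashback_kernel_structure {α : Type*} [DecidableEq α]
    (a : ℕ → α) (m : ℕ → ℕ) (r : ℕ) (hr : 1 ≤ r)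
    (hm : ∀ i, 1 ≤ i → i ≤ r → 1 ≤ m i)
    (ha : ∀ i, 1 ≤ i → i < r → a i ≠ a (i + 1))
    (s : List α) (hs : s = rleOfFun a m r) :
    (r % 2 = 1 →
      ((flashback s).getLastD default).sym =
        (List.replicate (m ((r + 1) / 2)) (a ((r + 1) / 2))).map Sum.inl) ∧
    (r % 2 = 0 →
      ((flashback s).getLastD default).sym =
        ((List.replicate (m ((r + 1) / 2)) (a ((r + 1) / 2)) ++
          List.replicate (m ((r + 1) / 2 + 1)) (a ((r + 1) / 2 + 1)))).map Sum.inl) ∧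
    ((flashback s).getLastD default).sym.toFinset.card ≤ 2 := by
  obtain ⟨n, rfl⟩ := Nat.exists_eq_add_of_le' hr
  have hrle : rleOfFun a m (n + 1) = runsFrom a m 1 (n + 1) := by
    simp [rleOfFun, runsFrom, Nat.add_comm 1]
  have hne : s ≠ [] := by
    rw [hs, hrle]
    exact runsFrom_ne_nil a m 1 n (hm 1 le_rfl hr)
  have key : ((flashback s).getLastD default).sym =
      runsFrom (Sum.inl ∘ a) m (1 + n / 2) (1 + n % 2) := by
    rw [flashback_eq_cons s hne, List.getLastD_cons, hs, hrle, map_runsFrom]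
    refine peelF_runsFrom_getLastD _ m n 1 _ _ ?_ (fun j _ _ => hm j (by omega) (by omega))
      (fun j _ _ h => ha j (by omega) (by omega) (Sum.inl_injective h))
    rw [← map_runsFrom, List.length_map]
    omega
  have hmid : (n + 1 + 1) / 2 = 1 + n / 2 := by omega
  rw [key, hmid]
  refine ⟨fun h => ?_, fun h => ?_, (card_toFinset_runsFrom_le _ _ _ _).trans (by omega)⟩
  · rw [show n % 2 = 0 by omega]
    simp [runsFrom]
  · rw [show n % 2 = 1 by omega]
    simp [runsFrom, List.range_succ]
end

section
/- Image characterization (necessity and sufficiency): let T = [(@$, 1), (σ₁, p₁), …, (σ_{k−1}, p_{k−1})] be a sequence of bilateral tokens with k ≥ 2 whose non-sentinel characters lie in Σ, and for non-terminal depths 1 ≤ d ≤ k−2 write a_d = σ_d[1] and c_d = σ_d[|σ_d|]. Then T lies in the image of the Flashback decomposition F if and only if: (1) for each 1 ≤ d ≤ k−2, p_d ≥ 1, |σ_d| − p_d ≥ 1, the front part σ_d[1..p_d] is a single run of a_d, and the back part σ_d[p_d+1..|σ_d|] is a single run of c_d; (2) p_{k−1} = 0 and σ_{k−1} is either a single run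 a^m or two adjacent runs a^ℓ c^b with a ≠ c; and (3) when k ≥ 3: a_{d+1} ≠ a_d and c_{d+1} ≠ c_d for 1 ≤ d ≤ k−3, the first character of σ_{k−1} differs from a_{k−2}, and the last character of σ_{k−1} differs from c_{k−2}. -/
/-- `PeelChain a c L`: the token sequence `L` satisfies the local run conditions of a Flashback
decomposition, and its outermost token starts with `a` and ends with `c`. -/
inductive PeelChain {β : Type*} : β → β → List (Tok β) → Prop
  | single (a : β) (l : ℕ) : PeelChain a a [⟨List.replicate (l + 1) a, 0⟩]
  | pair {a c : β} (l b : ℕ) (h : a ≠ c) :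
      PeelChain a c [⟨List.replicate (l + 1) a ++ List.replicate (b + 1) c, 0⟩]
  | cons {a c a' c' : β} {L : List (Tok β)} (l b : ℕ) (hL : PeelChain a' c' L)
      (ha : a' ≠ a) (hc : c' ≠ c) :
      PeelChain a c (⟨List.replicate (l + 1) a ++ List.replicate (b + 1) c, l + 1⟩ :: L)

section Runs

variable {β : Type*}

theorem eq_replicate_append_of_head? [DecidableEq β] {w : List β} {a : β}
    (h : w.head? = some a) :
    ∃ l r, w = List.replicate (l + 1) a ++ r ∧ r.head? ≠ some a := by
  induction w with
  | nil => simp at h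
  | cons x t ih =>
    obtain rfl : x = a := by simpa using h
    by_cases ht : t.head? = some x
    · obtain ⟨l, r, rfl, hr⟩ := ih ht
      exact ⟨l + 1, r, by simp [List.replicate_succ], hr⟩
    · exact ⟨0, t, by simp, ht⟩

theorem eq_append_replicate_of_getLast? [DecidableEq β] {w : List β} {c : β}
    (h : w.getLast? = some c) :
    ∃ b r, w = r ++ List.replicate (b + 1) c ∧ r.getLast? ≠ some c := by
  obtain ⟨b, r, hw, hr⟩ :=
    eq_replicate_append_of_head? (w := w.reverse) (by simpa using h)
  refine ⟨b, r.reverse, ?_, by simpa using hr⟩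
  simpa using congrArg List.reverse hw

/-- A nonempty string is a single run, two adjacent runs, or a nonempty middle wrapped by its
maximal leading and trailing runs. -/
theorem run_decomposition [DecidableEq β] {w : List β} {a c : β}
    (ha : w.head? = some a) (hc : w.getLast? = some c) :
    (a = c ∧ ∃ l, w = List.replicate (l + 1) a) ∨
    (a ≠ c ∧ ∃ l b, w = List.replicate (l + 1) a ++ List.replicate (b + 1) c) ∨
    ∃ l b mid a' c', w = List.replicate (l + 1) a ++ mid ++ List.replicate (b + 1) c ∧
      mid.head? = some a' ∧ mid.getLast? = some c' ∧ a' ≠ a ∧ c' ≠ c := by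
  obtain ⟨l, r, rfl, hr⟩ := eq_replicate_append_of_head? ha
  rcases r.eq_nil_or_concat with rfl | ⟨r₀, z, hz⟩
  · left
    simpa [List.getLast?_replicate] using hc
  · have hrc : r.getLast? = some c := by
      simpa [hz, List.concat_eq_append, ← List.append_assoc] using hc
    obtain ⟨b, mid, rfl, hmid⟩ := eq_append_replicate_of_getLast? hrc
    right
    rcases mid with _ | ⟨a', t⟩
    · left
      refine ⟨?_, l, b, by simp⟩
      rintro rfl
      simp [List.replicate_succ] at hr
    · right
      refine ⟨l, b, a' :: t, a', (a' :: t).getLast (by simp), by simp, rfl,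
        List.getLast?_eq_some_getLast _, ?_, ?_⟩
      · simpa using hr
      · simpa [List.getLast?_eq_some_getLast] using hmid

theorem takeWhile_eq_replicate_append [DecidableEq β] (a : β) (l : ℕ) {r : List β}
    (hr : r.head? ≠ some a) :
    (List.replicate l a ++ r).takeWhile (fun x => decide (x = a)) = List.replicate l a := by
  rw [List.takeWhile_append_of_pos (by simp [List.mem_replicate])]
  cases r <;> simp_all

theorem dropWhile_eq_replicate_append [DecidableEq β] (a : β) (l : ℕ) {r : List β}
    (hr : r.head? ≠ some a) :
    (List.replicate l a ++ r).dropWhile (fun x => decide (x = a)) = r := by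
  rw [List.dropWhile_append_of_pos (by simp [List.mem_replicate])]
  cases r <;> simp_all

theorem peelF_replicate_s15 [DecidableEq β] (fuel l : ℕ) (a : β) :
    peelF (fuel + 1) (List.replicate (l + 1) a) = [⟨List.replicate (l + 1) a, 0⟩] := by
  have h := dropWhile_eq_replicate_append a (l + 1) (r := []) (by simp)
  simp only [List.append_nil, List.replicate_succ] at h
  simp [List.replicate_succ, peelF, h]

/-- One peeling step on a string given with its maximal leading and trailing runs. -/
theorem peelF_replicate_append [DecidableEq β] (fuel l b : ℕ) {a c : β} {mid : List β}
    (ha : (mid ++ List.replicate (b + 1) c).head? ≠ some a)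
    (hc : (List.replicate (l + 1) a ++ mid).getLast? ≠ some c) :
    peelF (fuel + 1) (List.replicate (l + 1) a ++ mid ++ List.replicate (b + 1) c) =
      if mid.isEmpty then [⟨List.replicate (l + 1) a ++ List.replicate (b + 1) c, 0⟩]
      else ⟨List.replicate (l + 1) a ++ List.replicate (b + 1) c, l + 1⟩ :: peelF fuel mid := by
  have hf := takeWhile_eq_replicate_append a (l + 1) ha
  have hr := dropWhile_eq_replicate_append a (l + 1) ha
  have hb := takeWhile_eq_replicate_append c (b + 1)
    (r := (List.replicate (l + 1) a ++ mid).reverse) (by rwa [List.head?_reverse])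
  obtain ⟨t, ht⟩ : ∃ t, List.replicate (l + 1) a ++ mid ++ List.replicate (b + 1) c = a :: t :=
    ⟨_, by rw [List.replicate_succ]; rfl⟩
  have hz : (a :: t).getLastD a = c := by
    simp [← ht, List.getLast?_replicate]
  have hw : (a :: t).reverse =
      List.replicate (b + 1) c ++ (List.replicate (l + 1) a ++ mid).reverse := by
    rw [← ht]; simp
  rw [← List.append_assoc, ht] at hf hr
  rw [ht]
  simp only [peelF, hf, hr, hz, hw, hb]
  simp

end Runs

theorem peelChain_peelF {β : Type*} [DecidableEq β] (fuel : ℕ) {w : List β} {a c : β}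
    (hw : w.length ≤ fuel) (ha : w.head? = some a) (hc : w.getLast? = some c) :
    PeelChain a c (peelF fuel w) := by
  induction fuel generalizing w a c with
  | zero =>
    obtain rfl : w = [] := List.length_eq_zero_iff.mp (by omega)
    simp at ha
  | succ fuel ih =>
    rcases run_decomposition ha hc with ⟨rfl, l, rfl⟩ | ⟨hac, l, b, rfl⟩ |
      ⟨l, b, mid, a', c', rfl, hma, hmc, ha', hc'⟩
    · rw [peelF_replicate_s15]
      exact .single a l
    · have h := peelF_replicate_append fuel l b (a := a) (c := c) (mid := [])
        (by simpa [List.replicate_succ] using hac.symm)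
        (by simpa [List.getLast?_replicate] using hac)
      simp only [List.append_nil, List.isEmpty_nil, if_true] at h
      rw [h]
      exact .pair l b hac
    · have hne : mid ≠ [] := by rintro rfl; simp at hma
      rw [peelF_replicate_append fuel l b (by simpa [hma] using ha')
        (by simpa [hmc] using hc'), if_neg (by simpa using hne)]
      exact .cons l b (ih (by simp at hw; omega) hma hmc) ha' hc'

namespace PeelChain

variable {β : Type*} {a c : β} {L : List (Tok β)}

theorem ne_nil (h : PeelChain a c L) : L ≠ [] := by
  cases h <;> simp

theorem headI_getLastD [Inhabited β] {τ : Tok β} (h : PeelChain a c (τ :: L)) :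
    τ.sym.headI = a ∧ τ.sym.getLastD default = c := by
  constructor
  · cases h <;> simp [List.replicate_succ]
  · cases h <;> simp [List.getLast?_replicate]

end PeelChain

theorem nestTok_cons {β : Type*} (τ : Tok β) {L : List (Tok β)} (hL : L ≠ []) :
    nestTok (τ :: L) = τ.sym.take τ.split ++ nestTok L ++ τ.sym.drop τ.split := by
  cases L with
  | nil => exact absurd rfl hL
  | cons _ _ => rfl

theorem exists_mem_sym_of_mem_nestTok {β : Type*} {L : List (Tok β)} {x : β}
    (hx : x ∈ nestTok L) : ∃ τ ∈ L, x ∈ τ.sym := by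
  induction L with
  | nil => simp [nestTok] at hx
  | cons τ L ih =>
    by_cases hL : L = []
    · subst hL
      exact ⟨τ, by simp, hx⟩
    · rw [nestTok_cons τ hL, List.mem_append, List.mem_append] at hx
      rcases hx with (hx | hx) | hx
      · exact ⟨τ, by simp, List.mem_of_mem_take hx⟩
      · obtain ⟨σ, hσ, hxσ⟩ := ih hx
        exact ⟨σ, by simp [hσ], hxσ⟩
      · exact ⟨τ, by simp, List.mem_of_mem_drop hx⟩

theorem PeelChain.head?_getLast?_nestTok {β : Type*} {a c : β} {L : List (Tok β)}
    (h : PeelChain a c L) :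
    (nestTok L).head? = some a ∧ (nestTok L).getLast? = some c := by
  cases h with
  | single a l => simp [nestTok, List.head?_replicate, List.getLast?_replicate]
  | pair l b h => simp [nestTok, List.head?_replicate, List.getLast?_replicate]
  | cons l b hL ha hc =>
    rw [nestTok_cons _ hL.ne_nil]
    simp [List.head?_replicate, List.getLast?_replicate]

/-- Peeling inverts nesting on chains. -/
theorem PeelChain.peelF_nestTok {β : Type*} [DecidableEq β] {a c : β} {L : List (Tok β)}
    (h : PeelChain a c L) (fuel : ℕ) (hf : (nestTok L).length ≤ fuel) :
    peelF fuel (nestTok L) = L := by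
  induction h generalizing fuel with
  | single a l =>
    obtain ⟨fuel, rfl⟩ : ∃ n, fuel = n + 1 := ⟨fuel - 1, by simp [nestTok] at hf; omega⟩
    exact peelF_replicate_s15 fuel l a
  | @pair a c l b h =>
    obtain ⟨fuel, rfl⟩ : ∃ n, fuel = n + 1 := ⟨fuel - 1, by simp [nestTok] at hf; omega⟩
    simpa [nestTok] using peelF_replicate_append fuel l b (a := a) (c := c) (mid := [])
      (by simpa [List.replicate_succ] using h.symm)
      (by simpa [List.getLast?_replicate] using h)
  | @cons a c a' c' L l b hL ha hc ih =>
    obtain ⟨hha, hhc⟩ := hL.head?_getLast?_nestTok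
    have hne : nestTok L ≠ [] := by intro h; simp [h] at hha
    have heq : nestTok (⟨List.replicate (l + 1) a ++ List.replicate (b + 1) c, l + 1⟩ :: L) =
        List.replicate (l + 1) a ++ nestTok L ++ List.replicate (b + 1) c := by
      rw [nestTok_cons _ hL.ne_nil]
      simp
    rw [heq] at hf ⊢
    simp only [List.length_append, List.length_replicate] at hf
    obtain ⟨fuel, rfl⟩ : ∃ n, fuel = n + 1 := ⟨fuel - 1, by omega⟩
    rw [peelF_replicate_append fuel l b (by simpa [hha] using ha) (by simpa [hhc] using hc),
      if_neg (by simpa using hne), ih fuel (by omega)]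

/-- A non-terminal token: a nonempty run on either side of the split. -/
def Tok.IsBilateral {β : Type*} [Inhabited β] (τ : Tok β) : Prop :=
  1 ≤ τ.split ∧ τ.split < τ.sym.length ∧
    (∀ x ∈ τ.sym.take τ.split, x = τ.sym.headI) ∧
    (∀ x ∈ τ.sym.drop τ.split, x = τ.sym.getLastD default)

/-- A terminal token: split `0`, and one run or two adjacent runs. -/
def Tok.IsTerminal {β : Type*} (τ : Tok β) : Prop :=
  τ.split = 0 ∧
    ((∃ (b : β) (mm : ℕ), 1 ≤ mm ∧ τ.sym = List.replicate mm b) ∨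
     (∃ (b c : β) (l bb : ℕ), b ≠ c ∧ 1 ≤ l ∧ 1 ≤ bb ∧
        τ.sym = List.replicate l b ++ List.replicate bb c))

theorem Tok.isBilateral_iff {β : Type*} [Inhabited β] {τ : Tok β} :
    τ.IsBilateral ↔ ∃ a c l b,
      τ = ⟨List.replicate (l + 1) a ++ List.replicate (b + 1) c, l + 1⟩ := by
  constructor
  · rintro ⟨h1, h2, h3, h4⟩
    refine ⟨τ.sym.headI, τ.sym.getLastD default, τ.split - 1,
      τ.sym.length - τ.split - 1, ?_⟩
    have e1 := List.eq_replicate_of_mem h3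
    have e2 := List.eq_replicate_of_mem h4
    rw [List.length_take, min_eq_left h2.le] at e1
    rw [List.length_drop] at e2
    rw [Nat.sub_add_cancel h1, Nat.sub_add_cancel (by omega), ← e1, ← e2,
      List.take_append_drop]
  · rintro ⟨a, c, l, b, rfl⟩
    refine ⟨by simp, by simp, ?_, ?_⟩
    · simp [List.replicate_succ]
    · simp [List.getLast?_replicate]

theorem Tok.isTerminal_iff {β : Type*} {τ : Tok β} :
    τ.IsTerminal ↔ ∃ a c, PeelChain a c [τ] := by
  constructor
  · obtain ⟨s, p⟩ := τ
    rintro ⟨rfl, ⟨a, m, hm, rfl⟩ | ⟨a, c, l, b, hac, hl, hb, rfl⟩⟩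
    · obtain ⟨m, rfl⟩ := Nat.exists_eq_add_of_le' hm
      exact ⟨a, a, .single a m⟩
    · obtain ⟨l, rfl⟩ := Nat.exists_eq_add_of_le' hl
      obtain ⟨b, rfl⟩ := Nat.exists_eq_add_of_le' hb
      exact ⟨a, c, .pair l b hac⟩
  · rintro ⟨a, c, h⟩
    cases h with
    | single a l => exact ⟨rfl, .inl ⟨a, l + 1, by omega, rfl⟩⟩
    | pair l b h => exact ⟨rfl, .inr ⟨a, c, l + 1, b + 1, h, by omega, by omega, rfl⟩⟩
    | cons l b hL => exact absurd rfl hL.ne_nil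

theorem exists_peelChain_cons_iff {β : Type*} [Inhabited β] {τ σ : Tok β} {L : List (Tok β)} :
    (∃ a c, PeelChain a c (τ :: σ :: L)) ↔
      τ.IsBilateral ∧ σ.sym.headI ≠ τ.sym.headI ∧
        σ.sym.getLastD default ≠ τ.sym.getLastD default ∧ ∃ a c, PeelChain a c (σ :: L) := by
  constructor
  · rintro ⟨a, c, h⟩
    obtain ⟨h1, h2⟩ := h.headI_getLastD
    rw [h1, h2]
    cases h with
    | cons l b hL ha hc =>
      obtain ⟨h3, h4⟩ := hL.headI_getLastD
      rw [h3, h4]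
      exact ⟨Tok.isBilateral_iff.mpr ⟨_, _, _, _, rfl⟩, ha, hc, _, _, hL⟩
  · rintro ⟨hτ, h1, h2, a', c', hL⟩
    obtain ⟨a, c, l, b, rfl⟩ := Tok.isBilateral_iff.mp hτ
    obtain ⟨h3, h4⟩ := hL.headI_getLastD
    rw [h3] at h1
    rw [h4] at h2
    exact ⟨a, c, .cons l b hL (by simpa [List.replicate_succ] using h1)
      (by simpa [List.getLastD_eq_getLast?, List.getLast?_replicate] using h2)⟩

theorem exists_peelChain_iff_getD {β : Type*} [Inhabited β] {L : List (Tok β)} (hL : L ≠ []) :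
    (∃ a c, PeelChain a c L) ↔
      (∀ i, i + 1 < L.length → (L.getD i default).IsBilateral ∧
        (L.getD (i + 1) default).sym.headI ≠ (L.getD i default).sym.headI ∧
        (L.getD (i + 1) default).sym.getLastD default ≠
          (L.getD i default).sym.getLastD default) ∧
      (L.getD (L.length - 1) default).IsTerminal := by
  induction L with
  | nil => exact absurd rfl hL
  | cons τ L ih =>
    cases L with
    | nil => simp [Tok.isTerminal_iff]
    | cons σ L =>
      rw [exists_peelChain_cons_iff, ih (by simp)]
      constructor
      · rintro ⟨h1, h2, h3, h4, h5⟩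
        refine ⟨?_, by simpa using h5⟩
        rintro (_ | i) hi
        · exact ⟨h1, h2, h3⟩
        · exact h4 i (by simpa using hi)
      · rintro ⟨h1, h2⟩
        obtain ⟨h3, h4, h5⟩ := h1 0 (by simp)
        exact ⟨h3, h4, h5, fun i hi => h1 (i + 1) (by simpa using hi), by simpa using h2⟩

theorem flashback_nil {α : Type*} [DecidableEq α] :
    flashback ([] : List α) = [⟨[atSym, dollarSym], 0⟩] := by
  simp [flashback, wrap, peelF, atSym, dollarSym]

theorem flashback_of_ne_nil {α : Type*} [DecidableEq α] {s : List α} (hs : s ≠ []) :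
    flashback s = ⟨[atSym, dollarSym], 1⟩ ::
      peelF (s.length + 1) (s.map Sum.inl) := by
  have h := peelF_replicate_append (s.length + 1) 0 0 (a := (atSym : Symb α))
    (c := dollarSym) (mid := s.map Sum.inl)
    (by cases s <;> simp [atSym, dollarSym])
    (by rcases s.eq_nil_or_concat with rfl | ⟨t, z, rfl⟩ <;>
      simp [atSym, dollarSym, List.getLast?_cons])
  rw [if_neg (by simpa using hs)] at h
  simpa [flashback, wrap] using h

/-- Behind the sentinel token, the image of `F` consists of the chains over the alphabet. -/
theorem exists_flashback_eq_cons_iff {α : Type*} [DecidableEq α] {L : List (Tok (Symb α))}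
    (hSigma : ∀ τ ∈ L, ∀ x ∈ τ.sym, ∃ b : α, x = Sum.inl b) :
    (∃ s : List α, flashback s = ⟨[atSym, dollarSym], 1⟩ :: L) ↔
      ∃ a c, PeelChain a c L := by
  constructor
  · rintro ⟨s, hs⟩
    have hne : s ≠ [] := by
      rintro rfl
      simp [flashback_nil] at hs
    rw [flashback_of_ne_nil hne, List.cons.injEq] at hs
    have hne' : s.map (Sum.inl : α → Symb α) ≠ [] := by simpa using hne
    rw [← hs.2]
    exact ⟨_, _, peelChain_peelF _ (by simp) (List.head?_eq_some_head hne')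
      (List.getLast?_eq_some_getLast hne')⟩
  · rintro ⟨a, c, h⟩
    have hall : ∀ x ∈ nestTok L, x ∈ Set.range (Sum.inl : α → Symb α) := fun x hx => by
      obtain ⟨τ, hτ, hxτ⟩ := exists_mem_sym_of_mem_nestTok hx
      obtain ⟨b, rfl⟩ := hSigma τ hτ x hxτ
      exact ⟨b, rfl⟩
    obtain ⟨s, hs⟩ : nestTok L ∈ Set.range (List.map (Sum.inl : α → Symb α)) := by
      rw [Set.range_list_map]
      exact hall
    have hne : s ≠ [] := by
      rintro rfl
      have := h.head?_getLast?_nestTok.1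
      simp [← hs] at this
    refine ⟨s, ?_⟩
    rw [flashback_of_ne_nil hne, hs, h.peelF_nestTok _ (by simp [← hs])]

/-- **Image characterisation.**  Let `T = [(@$,1), (σ₁,p₁), …, (σ_{k-1},p_{k-1})]`
be a sequence of bilateral tokens with `k ≥ 2` whose non-sentinel characters
lie in `Σ`, and for `1 ≤ d ≤ k-2` write `a_d` for the first and `c_d` for the
last character of `σ_d`.  Then `T` lies in the image of `F` if and only if:
(1) for each `1 ≤ d ≤ k-2`, `p_d ≥ 1`, `|σ_d| - p_d ≥ 1`, the front part is a
single run of `a_d` and the back part is a single run of `c_d`;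
(2) `p_{k-1} = 0` and `σ_{k-1}` is a single run `a^m` or two adjacent runs
`a^ℓ c^b` with `a ≠ c`; and
(3) when `k ≥ 3`: `a_{d+1} ≠ a_d` and `c_{d+1} ≠ c_d` for `1 ≤ d ≤ k-3`, the
first character of `σ_{k-1}` differs from `a_{k-2}`, and the last character of
`σ_{k-1}` differs from `c_{k-2}`. -/
theorem flashback_image_characterisation {α : Type*} [DecidableEq α]
    (T : List (Tok (Symb α))) (k : ℕ) (hk : k = T.length) (hk2 : 2 ≤ k)
    (h0 : T.getD 0 default = ⟨[atSym, dollarSym], 1⟩)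
    (hSigma : ∀ d, 1 ≤ d → d < k →
      ∀ x ∈ (T.getD d default).sym, ∃ b : α, x = Sum.inl b) :
    (∃ s : List α, flashback s = T) ↔
      ((∀ d, 1 ≤ d → d ≤ k - 2 →
          1 ≤ (T.getD d default).split ∧
          (T.getD d default).split < (T.getD d default).sym.length ∧
          (∀ x ∈ (T.getD d default).sym.take (T.getD d default).split,
            x = (T.getD d default).sym.headI) ∧
          (∀ x ∈ (T.getD d default).sym.drop (T.getD d default).split,
            x = (T.getD d default).sym.getLastD default)) ∧
       ((T.getD (k - 1) default).split = 0 ∧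
        ((∃ (b : Symb α) (mm : ℕ), 1 ≤ mm ∧
            (T.getD (k - 1) default).sym = List.replicate mm b) ∨
         (∃ (b c : Symb α) (l bb : ℕ), b ≠ c ∧ 1 ≤ l ∧ 1 ≤ bb ∧
            (T.getD (k - 1) default).sym =
              List.replicate l b ++ List.replicate bb c))) ∧
       (3 ≤ k →
         (∀ d, 1 ≤ d → d ≤ k - 3 →
            (T.getD (d + 1) default).sym.headI ≠ (T.getD d default).sym.headI ∧
            (T.getD (d + 1) default).sym.getLastD default ≠
              (T.getD d default).sym.getLastD default) ∧
         (T.getD (k - 1) default).sym.headI ≠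
            (T.getD (k - 2) default).sym.headI ∧
         (T.getD (k - 1) default).sym.getLastD default ≠
            (T.getD (k - 2) default).sym.getLastD default)) := by
  obtain _ | ⟨τ, L⟩ := T
  · simp at hk; omega
  obtain rfl : τ = ⟨[atSym, dollarSym], 1⟩ := h0
  have hlen : k = L.length + 1 := by simpa using hk
  have hL : L ≠ [] := by
    rintro rfl
    simp at hlen; omega
  have hmem : ∀ τ ∈ L, ∀ x ∈ τ.sym, ∃ b : α, x = Sum.inl b := by
    intro τ hτ
    obtain ⟨i, hi, rfl⟩ := List.getElem_of_mem hτ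
    have := hSigma (i + 1) (by omega) (by omega)
    rwa [List.getD_cons_succ, List.getD_eq_getElem _ _ hi] at this
  rw [exists_flashback_eq_cons_iff hmem, exists_peelChain_iff_getD hL]
  obtain ⟨m, hm⟩ : ∃ m, L.length = m + 1 := ⟨L.length - 1, by omega⟩
  obtain rfl : k = m + 2 := by omega
  rw [hm]
  constructor
  · rintro ⟨h1, h2⟩
    refine ⟨?_, h2, fun h3 => ⟨?_, ?_⟩⟩
    · rintro (_ | d) hd hd'
      · omega
      · exact (h1 d (by omega)).1
    · rintro (_ | d) hd hd'
      · omega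
      · exact (h1 d (by omega)).2
    · obtain ⟨m, rfl⟩ : ∃ n, m = n + 1 := ⟨m - 1, by omega⟩
      exact (h1 m (by omega)).2
  · rintro ⟨h1, h2, h3⟩
    refine ⟨fun i hi => ⟨h1 (i + 1) (by omega) (by omega), ?_⟩, h2⟩
    obtain ⟨h4, h5⟩ := h3 (by omega)
    obtain h | rfl : i + 1 < m ∨ m = i + 1 := by omega
    · exact h4 (i + 1) (by omega) (by omega)
    · exact h5
end

section
/- Right inverse on valid token sequences: for every token sequence T in the image of the Flashback decomposition F (equivalently, every T satisfying the token-form, terminal-form, and alternation conditions of the image characterization), F(F⁻¹(T)) = T. -/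
/-- The maximal trailing run of a string that is not a single run is disjoint from the maximal
leading run, so it is a suffix of what remains once the leading run is removed. -/
theorem trailing_run_suffix_of_dropWhile_ne_nil {β : Type*} [DecidableEq β] (a z : β) (w : List β)
    (h : w.dropWhile (fun x => decide (x = a)) ≠ []) :
    (w.reverse.takeWhile (fun x => decide (x = z))).reverse <:+
      w.dropWhile (fun x => decide (x = a)) := by
  rw [← List.reverse_reverse (w.dropWhile _), List.reverse_suffix]
  conv_lhs => rw [← List.takeWhile_append_dropWhile (p := fun x => decide (x = a)) (l := w)]
  rw [List.reverse_append, List.takeWhile_append]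
  split_ifs with hlen
  · have hz : ∀ x ∈ (w.dropWhile (fun x => decide (x = a))).reverse, x = z := by
      have := (List.takeWhile_sublist (l := (w.dropWhile (fun x => decide (x = a))).reverse)
        (fun x => decide (x = z))).eq_of_length hlen
      simpa using List.takeWhile_eq_self_iff.1 this
    have hza : z ≠ a := by
      have hhead := List.head_dropWhile_not (fun x => decide (x = a)) h
      rw [hz _ (List.mem_reverse.2 (List.head_mem h))] at hhead
      simpa using hhead
    have hnil : (w.takeWhile (fun x => decide (x = a))).reverse.takeWhile
        (fun x => decide (x = z)) = [] := by
      refine List.eq_nil_iff_forall_not_mem.2 fun x hx => hza ?_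
      have hxz := List.mem_takeWhile_imp hx
      have hxa := List.mem_takeWhile_imp (List.mem_reverse.1 ((List.takeWhile_sublist _).subset hx))
      rw [← of_decide_eq_true hxz, of_decide_eq_true hxa]
    rw [hnil, List.append_nil]
  · exact ⟨_, List.takeWhile_append_dropWhile⟩

theorem nestTok_peelF {β : Type*} [DecidableEq β] (fuel : ℕ) (w : List β)
    (h : w.length ≤ fuel) : nestTok (peelF fuel w) = w := by
  induction fuel generalizing w with
  | zero => simp [List.length_eq_zero_iff.1 (Nat.le_zero.1 h), peelF, nestTok]
  | succ fuel ih =>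
    cases w with
    | nil => simp [peelF, nestTok]
    | cons a t =>
      have hsplit := List.takeWhile_append_dropWhile (p := fun x => decide (x = a)) (l := a :: t)
      have hfront : 0 < ((a :: t).takeWhile (fun x => decide (x = a))).length := by simp
      have hsuffix := trailing_run_suffix_of_dropWhile_ne_nil a ((a :: t).getLastD a) (a :: t)
      unfold peelF
      extract_lets w front rest z back mid
      change front ++ rest = w at hsplit
      change 0 < front.length at hfront
      change rest ≠ [] → back <:+ rest at hsuffix
      by_cases hrest : rest = []
      · simp [hrest, nestTok, w]
      · have hmid : mid ++ back = rest :=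
          List.suffix_iff_eq_append.1 (hsuffix hrest)
        have hlen : mid.length ≤ fuel := by
          have := congrArg List.length hsplit
          have := congrArg List.length hmid
          have : w.length ≤ fuel + 1 := h
          simp only [List.length_append] at *
          omega
        have hnest := ih mid hlen
        by_cases hnil : mid = []
        · have hback : back = rest := by simpa [hnil] using hmid
          simp [hrest, hnil, nestTok, hback, hsplit, w]
        · have hpeel : peelF fuel mid ≠ [] := fun he => hnil (by rw [← hnest, he, nestTok])
          simp only [List.isEmpty_iff, hrest, hnil, if_false]
          rw [nestTok.eq_3 _ _ hpeel, hnest, List.take_left, List.drop_left, List.append_assoc,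
            hmid, hsplit]

theorem reconstruct_flashback {α : Type*} [DecidableEq α] (s : List α) :
    reconstruct (flashback s) = s := by
  have hmap : (s.map (Sum.inl : α → Symb α)).filterMap Sum.getLeft? = s := by
    rw [List.filterMap_map]
    exact List.filterMap_some
  rw [reconstruct, flashback, nestTok_peelF _ _ le_rfl]
  simpa [wrap] using hmap

/-- **Right inverse on valid token sequences.**  For every token sequence `T`
in the image of the Flashback decomposition `F`, we have `F(F⁻¹(T)) = T`. -/
theorem flashback_right_inverse {α : Type*} [DecidableEq α]
    (T : List (Tok (Symb α))) (h : ∃ s : List α, flashback s = T) :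
    flashback (reconstruct T) = T := by
  obtain ⟨s, rfl⟩ := h
  rw [reconstruct_flashback]
end
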